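/- Let (X^s, p^s) ∈ ℝ^{N^s×N^s} × 𝒫_{N^s} for s = 1,…,S be finite networks, let M ∈ ℕ, let q ∈ 𝒫_M have all entries strictly positive, let λ ∈ Δ_{S−1}, and suppose Y_λ ∈ ℝ^{M×M} minimizes Y ↦ Σ_{s=1}^S λ_s GW²((X^s,p^s),(Y,q)) over ℝ^{M×M}. If for each s both π^{*s} and π̃^{*s} in Π(p^s, q) are optimal couplings for GW((X^s,p^s),(Y_λ,q)), then (1/(qqᵀ)) ⊙ Σ_{s=1}^S λ_s (π^{*s})ᵀ X^s π^{*s} = (1/(qqᵀ)) ⊙ Σ_{s=1}^S λ_s (π̃^{*s})ᵀ X^s π̃^{*s}; that is, the fixed-point formula for the barycenter does not depend on the choice of optimal couplings. -/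

import Mathlib

open Finset Matrix

noncomputable section

/-- `p` is a probability vector on `Fin N`. -/
def IsProbVec {N : ℕ} (p : Fin N → ℝ) : Prop :=
  (∀ i, 0 ≤ p i) ∧ ∑ i, p i = 1

/-- The set of couplings `Π(p,q)` between probability vectors `p` and `q`. -/
def Couplings {N M : ℕ} (p : Fin N → ℝ) (q : Fin M → ℝ) :
    Set (Matrix (Fin N) (Fin M) ℝ) :=
  {π | (∀ i j, 0 ≤ π i j) ∧ (∀ i, ∑ j, π i j = p i) ∧ (∀ j, ∑ i, π i j = q j)}

/-- The Gromov–Wasserstein objective for a coupling `π`. -/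
def GWobj {N M : ℕ} (X : Matrix (Fin N) (Fin N) ℝ) (Y : Matrix (Fin M) (Fin M) ℝ)
    (π : Matrix (Fin N) (Fin M) ℝ) : ℝ :=
  ∑ i, ∑ k, ∑ j, ∑ l, (X i k - Y j l) ^ 2 * π i j * π k l

/-- The squared Gromov–Wasserstein discrepancy `GW²((X,p),(Y,q))`. -/
def GW2 {N M : ℕ} (X : Matrix (Fin N) (Fin N) ℝ) (p : Fin N → ℝ)
    (Y : Matrix (Fin M) (Fin M) ℝ) (q : Fin M → ℝ) : ℝ :=
  sInf (GWobj X Y '' Couplings p q)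

/-- `π` is an optimal coupling for `GW((X,p),(Y,q))`: it is a coupling attaining
the minimum defining `GW²`. -/
def IsOptimalCoupling {N M : ℕ} (X : Matrix (Fin N) (Fin N) ℝ) (p : Fin N → ℝ)
    (Y : Matrix (Fin M) (Fin M) ℝ) (q : Fin M → ℝ)
    (π : Matrix (Fin N) (Fin M) ℝ) : Prop :=
  π ∈ Couplings p q ∧ GWobj X Y π = GW2 X p Y q

theorem GWobj_expand {N M : ℕ} (X : Matrix (Fin N) (Fin N) ℝ) (Y : Matrix (Fin M) (Fin M) ℝ)
    (q : Fin M → ℝ) (π : Matrix (Fin N) (Fin M) ℝ) (h : ∀ j, ∑ i, π i j = q j) :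
    GWobj X Y π = GWobj X 0 π
      + ∑ j, ∑ l, (Y j l ^ 2 * (q j * q l) - 2 * Y j l * (πᵀ * X * π) j l) := by
  have e : ∀ Z : Matrix (Fin M) (Fin M) ℝ, GWobj X Z π
      = ∑ j, ∑ l, ∑ i, ∑ k, (X i k - Z j l) ^ 2 * π i j * π k l := by
    intro Z
    unfold GWobj
    calc _ = ∑ i, ∑ j, ∑ k, ∑ l, (X i k - Z j l) ^ 2 * π i j * π k l :=
          Finset.sum_congr rfl fun i _ => Finset.sum_comm
      _ = ∑ j, ∑ i, ∑ k, ∑ l, (X i k - Z j l) ^ 2 * π i j * π k l := Finset.sum_comm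
      _ = ∑ j, ∑ i, ∑ l, ∑ k, (X i k - Z j l) ^ 2 * π i j * π k l :=
          Finset.sum_congr rfl fun j _ => Finset.sum_congr rfl fun i _ => Finset.sum_comm
      _ = _ := Finset.sum_congr rfl fun j _ => Finset.sum_comm
  rw [e Y, e 0, ← Finset.sum_add_distrib]
  refine Finset.sum_congr rfl fun j _ => ?_
  rw [← Finset.sum_add_distrib]
  refine Finset.sum_congr rfl fun l _ => ?_
  have h1 : (πᵀ * X * π) j l = ∑ i, ∑ k, X i k * π i j * π k l := by
    simp only [Matrix.mul_apply, Matrix.transpose_apply, Finset.sum_mul]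
    rw [Finset.sum_comm]
    refine Finset.sum_congr rfl fun i _ => Finset.sum_congr rfl fun k _ => ?_
    ring
  have h2 : q j * q l = ∑ i, ∑ k, π i j * π k l := by
    rw [← h j, ← h l, Finset.sum_mul_sum]
  rw [h1, h2]
  simp only [Finset.mul_sum, ← Finset.sum_sub_distrib, ← Finset.sum_add_distrib]
  refine Finset.sum_congr rfl fun i _ => Finset.sum_congr rfl fun k _ => ?_
  simp only [Matrix.zero_apply]
  ring

theorem GW2_le_obj {N M : ℕ} (X : Matrix (Fin N) (Fin N) ℝ) (p : Fin N → ℝ)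
    (Y : Matrix (Fin M) (Fin M) ℝ) (q : Fin M → ℝ) (π : Matrix (Fin N) (Fin M) ℝ)
    (h : π ∈ Couplings p q) : GW2 X p Y q ≤ GWobj X Y π := by
  refine csInf_le ⟨0, ?_⟩ ⟨π, h, rfl⟩
  rintro _ ⟨σ, hσ, rfl⟩
  unfold GWobj
  refine Finset.sum_nonneg fun i _ => Finset.sum_nonneg fun k _ => Finset.sum_nonneg fun j _ =>
    Finset.sum_nonneg fun l _ => ?_
  exact mul_nonneg (mul_nonneg (sq_nonneg _) (hσ.1 i j)) (hσ.1 k l)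

theorem bary_eq {S M : ℕ} (N : Fin S → ℕ)
    (X : ∀ s, Matrix (Fin (N s)) (Fin (N s)) ℝ)
    (p : ∀ s, Fin (N s) → ℝ)
    (q : Fin M → ℝ) (hqpos : ∀ j, 0 < q j)
    (lam : Fin S → ℝ) (hlam : IsProbVec lam)
    (Ylam : Matrix (Fin M) (Fin M) ℝ)
    (hbary : ∀ Y : Matrix (Fin M) (Fin M) ℝ,
        ∑ s, lam s * GW2 (X s) (p s) Ylam q ≤ ∑ s, lam s * GW2 (X s) (p s) Y q)
    (πs : ∀ s, Matrix (Fin (N s)) (Fin M) ℝ)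
    (hopt : ∀ s, IsOptimalCoupling (X s) (p s) Ylam q (πs s)) (j l : Fin M) :
    (1 / (q j * q l)) * ∑ s, lam s * ((πs s)ᵀ * X s * πs s) j l = Ylam j l := by
  set B : Matrix (Fin M) (Fin M) ℝ := fun j l => ∑ s, lam s * ((πs s)ᵀ * X s * πs s) j l with hB
  have hF : ∀ Y : Matrix (Fin M) (Fin M) ℝ, ∑ s, lam s * GWobj (X s) Y (πs s)
      = ∑ s, lam s * GWobj (X s) 0 (πs s)
        + ∑ j, ∑ l, (Y j l ^ 2 * (q j * q l) - 2 * Y j l * B j l) := by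
    intro Y
    have : ∀ s, lam s * GWobj (X s) Y (πs s) = lam s * GWobj (X s) 0 (πs s)
        + ∑ j, ∑ l, (lam s * (Y j l ^ 2 * (q j * q l))
          - 2 * Y j l * (lam s * ((πs s)ᵀ * X s * πs s) j l)) := by
      intro s
      rw [GWobj_expand (X s) Y q (πs s) (hopt s).1.2.2, mul_add, Finset.mul_sum]
      congr 1
      refine Finset.sum_congr rfl fun j _ => ?_
      rw [Finset.mul_sum]
      refine Finset.sum_congr rfl fun l _ => ?_
      ring
    rw [Finset.sum_congr rfl fun s _ => this s, Finset.sum_add_distrib, Finset.sum_comm]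
    congr 1
    refine Finset.sum_congr rfl fun j _ => ?_
    rw [Finset.sum_comm]
    refine Finset.sum_congr rfl fun l _ => ?_
    rw [Finset.sum_sub_distrib, ← Finset.sum_mul, ← Finset.mul_sum, hlam.2, one_mul]
  set Y0 : Matrix (Fin M) (Fin M) ℝ := fun j l => (1 / (q j * q l)) * B j l with hY0
  have hle : ∑ s, lam s * GWobj (X s) Ylam (πs s) ≤ ∑ s, lam s * GWobj (X s) Y0 (πs s) := by
    calc _ = ∑ s, lam s * GW2 (X s) (p s) Ylam q :=
          Finset.sum_congr rfl fun s _ => by rw [(hopt s).2]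
      _ ≤ _ := hbary Y0
      _ ≤ _ := Finset.sum_le_sum fun s _ =>
          mul_le_mul_of_nonneg_left (GW2_le_obj _ _ _ _ _ (hopt s).1) (hlam.1 s)
  rw [hF Ylam, hF Y0] at hle
  have hd : ∑ j, ∑ l, (q j * q l) * (Ylam j l - Y0 j l) ^ 2 ≤ 0 := by
    have : ∑ j, ∑ l, (q j * q l) * (Ylam j l - Y0 j l) ^ 2
        = ∑ j, ∑ l, (Ylam j l ^ 2 * (q j * q l) - 2 * Ylam j l * B j l)
          - ∑ j, ∑ l, (Y0 j l ^ 2 * (q j * q l) - 2 * Y0 j l * B j l) := by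
      simp only [← Finset.sum_sub_distrib]
      refine Finset.sum_congr rfl fun j _ => Finset.sum_congr rfl fun l _ => ?_
      have hb : B j l = (q j * q l) * Y0 j l := by
        have := (hqpos j).ne'
        have := (hqpos l).ne'
        simp only [hY0]
        field_simp
      rw [hb]
      ring
    linarith
  have hn : ∀ j l, 0 ≤ (q j * q l) * (Ylam j l - Y0 j l) ^ 2 := fun j l =>
    mul_nonneg (mul_pos (hqpos j) (hqpos l)).le (sq_nonneg _)
  have h1 : (q j * q l) * (Ylam j l - Y0 j l) ^ 2 ≤ 0 :=
    ((Finset.single_le_sum (f := fun l => (q j * q l) * (Ylam j l - Y0 j l) ^ 2)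
      (fun l _ => hn j l) (Finset.mem_univ l)).trans
      (Finset.single_le_sum (f := fun j => ∑ l, (q j * q l) * (Ylam j l - Y0 j l) ^ 2)
        (fun j _ => Finset.sum_nonneg fun l _ => hn j l) (Finset.mem_univ j))).trans hd
  have h2 := le_antisymm h1 (hn j l)
  have h3 := (mul_eq_zero.1 h2).resolve_left (mul_pos (hqpos j) (hqpos l)).ne'
  have h4 : Ylam j l - Y0 j l = 0 := pow_eq_zero_iff (two_ne_zero) |>.1 h3
  change Y0 j l = Ylam j l
  linarith

/-- If `Y_λ` minimizes `Y ↦ Σ_s λ_s GW²((X^s,p^s),(Y,q))` and, for each `s`,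
both `π^{*s}` and `π̃^{*s}` are optimal couplings for `GW((X^s,p^s),(Y_λ,q))`, then the
fixed-point formula yields the same matrix for both families of optimal couplings. -/
theorem fixed_point_formula_independent_of_optimal_plans {S M : ℕ} (N : Fin S → ℕ)
    (X : ∀ s, Matrix (Fin (N s)) (Fin (N s)) ℝ)
    (p : ∀ s, Fin (N s) → ℝ) (hp : ∀ s, IsProbVec (p s))
    (q : Fin M → ℝ) (hq : IsProbVec q) (hqpos : ∀ j, 0 < q j)
    (lam : Fin S → ℝ) (hlam : IsProbVec lam)
    (Ylam : Matrix (Fin M) (Fin M) ℝ)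
    (hbary : ∀ Y : Matrix (Fin M) (Fin M) ℝ,
        ∑ s, lam s * GW2 (X s) (p s) Ylam q ≤ ∑ s, lam s * GW2 (X s) (p s) Y q)
    (πs πs' : ∀ s, Matrix (Fin (N s)) (Fin M) ℝ)
    (hopt : ∀ s, IsOptimalCoupling (X s) (p s) Ylam q (πs s))
    (hopt' : ∀ s, IsOptimalCoupling (X s) (p s) Ylam q (πs' s)) :
    ∀ j l, (1 / (q j * q l)) * ∑ s, lam s * ((πs s)ᵀ * X s * πs s) j l
      = (1 / (q j * q l)) * ∑ s, lam s * ((πs' s)ᵀ * X s * πs' s) j l := by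
  intro j l
  rw [bary_eq N X p q hqpos lam hlam Ylam hbary πs hopt j l,
    bary_eq N X p q hqpos lam hlam Ylam hbary πs' hopt' j l]
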